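/- On M_4(ℂ) ≅ M_2(ℂ) ⊗ M_2(ℂ), let D = Σ_{i=1}^3 D_{L_i} with jump operators L_1 = (σᶻ + 2σ⁻) ⊗ I, L_2 = |1⟩⟨1| ⊗ σ⁻, L_3 = |1⟩⟨1| ⊗ σ⁺, and consider the time-dependent Lindbladian L_t(x) = −i[H(t), x] + D(x) with H(t) = (σʸ + cos(φ(t))·σˣ + sin(φ(t))·σʸ) ⊗ I, where φ(t) = 2π·(1 + c·t)^r. Suppose the constants satisfy r > 2, c > 0 and 4 + 9/(c·(r − 2)) < 2π·r·c. Then for any solutions ρ, σ of the master equation with initial values ρ(0) = |0⟩⟨0| ⊗ |0⟩⟨0| and σ(0) = |0⟩⟨0| ⊗ |1⟩⟨1|, one has ‖ρ(t) − σ(t)‖₁ ≥ 2 − (1/(π·r·c))·(9/(c·(r − 2)) + 4) > 0 for all t ≥ 0. In particular, L_t is not asymptotically contractive and hence not exponentially contractive. -/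

import Mathlib

open scoped ComplexOrder Kronecker
open Matrix

namespace Paper

variable {n : Type*} [Fintype n] [DecidableEq n]

/-- Trace norm: sum of singular values. -/
noncomputable def traceNorm (A : Matrix n n ℂ) : ℝ :=
  ∑ i, Real.sqrt ((Matrix.posSemidef_conjTranspose_mul_self A).isHermitian.eigenvalues i)

/-- The dissipator associated with a single jump operator. -/
noncomputable def dissipator (L x : Matrix n n ℂ) : Matrix n n ℂ :=
  L * x * Lᴴ - ((1 : ℂ)/2) • (Lᴴ * L * x + x * (Lᴴ * L))

/-- Total dissipator of a family of jump operators. -/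
noncomputable def totalDissipator {m : ℕ} (L : Fin m → Matrix n n ℂ) (x : Matrix n n ℂ) :
    Matrix n n ℂ :=
  ∑ j, dissipator (L j) x

/-- The Hamiltonian commutator term `-i[H, x]`. -/
noncomputable def hamTerm (H x : Matrix n n ℂ) : Matrix n n ℂ :=
  (-Complex.I) • (H * x - x * H)

/-- A solution of the master equation `ρ' = L_t(ρ)` starting at time `s`
(differentiable entrywise). -/
def IsSolution (Lt : ℝ → Matrix n n ℂ → Matrix n n ℂ) (s : ℝ) (ρ : ℝ → Matrix n n ℂ) : Prop :=
  ∀ t, s ≤ t → ∀ i j, HasDerivAt (fun u => ρ u i j) ((Lt t (ρ t)) i j) t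

/-- Density matrix: Hermitian, positive semidefinite, trace one. -/
def IsDensity (ρ : Matrix n n ℂ) : Prop := ρ.PosSemidef ∧ ρ.trace = 1

/-- Exponential contractivity with constants `K, γ` of a time-dependent Lindbladian. -/
def ExpContractiveWith (Lt : ℝ → Matrix n n ℂ → Matrix n n ℂ) (K γ : ℝ) : Prop :=
  ∀ s t : ℝ, 0 ≤ s → s ≤ t → ∀ ρ σ : ℝ → Matrix n n ℂ,
    IsSolution Lt s ρ → IsSolution Lt s σ → IsDensity (ρ s) → IsDensity (σ s) →
    traceNorm (ρ t - σ t) ≤ K * Real.exp (-γ * (t - s)) * traceNorm (ρ s - σ s)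

/-- Exponential contractivity of a time-dependent Lindbladian. -/
def ExpContractive (Lt : ℝ → Matrix n n ℂ → Matrix n n ℂ) : Prop :=
  ∃ K γ : ℝ, 0 < K ∧ 0 < γ ∧ ExpContractiveWith Lt K γ

/-- Time-dependent Hamiltonian: Hermitian values and continuous entries. -/
def IsHamiltonianFamily (H : ℝ → Matrix n n ℂ) : Prop :=
  (∀ t, (H t).IsHermitian) ∧ ∀ i j, Continuous fun t => H t i j

/-- Driven Lindbladian `x ↦ -i[H(t), x] + D(x)`. -/
noncomputable def driven {m : ℕ} (H : ℝ → Matrix n n ℂ) (L : Fin m → Matrix n n ℂ)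
    (t : ℝ) (x : Matrix n n ℂ) : Matrix n n ℂ :=
  hamTerm (H t) x + totalDissipator L x

/-- Hamiltonian-independent contractivity of a dissipator. -/
def HamIndepContractive {m : ℕ} (L : Fin m → Matrix n n ℂ) : Prop :=
  ∀ H : ℝ → Matrix n n ℂ, IsHamiltonianFamily H → ExpContractive (driven H L)

/-- The operator norm (largest singular value). -/
noncomputable def opNorm (A : Matrix n n ℂ) : ℝ :=
  ‖LinearMap.toContinuousLinearMap (Matrix.toEuclideanLin A)‖

end Paper

namespace Paper

theorem exists_linear_ode {E : Type*} [NormedAddCommGroup E] [NormedSpace ℝ E] [CompleteSpace E]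
    (A : ℝ → E →L[ℝ] E) (hA : Continuous A) (M : ℝ) (hM : 0 < M) (hAM : ∀ t, ‖A t‖ ≤ M) (x0 : E) :
    ∃ x : ℝ → E, x 0 = x0 ∧ ∀ t, 0 ≤ t → HasDerivAt x (A t (x t)) t := by
  have hcont : ∀ y : BoundedContinuousFunction ℝ E,
      Continuous fun s => Real.exp (2 * M * s) • A s (y s) := by
    intro y
    have := y.continuous
    fun_prop
  have hder : ∀ (y : BoundedContinuousFunction ℝ E) (t : ℝ),
      HasDerivAt (fun t => ∫ s in (0 : ℝ)..t, Real.exp (2 * M * s) • A s (y s))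
        (Real.exp (2 * M * t) • A t (y t)) t := fun y t =>
    intervalIntegral.integral_hasDerivAt_right ((hcont y).intervalIntegrable _ _)
      ((hcont y).stronglyMeasurableAtFilter _ _) (hcont y).continuousAt
  have hexp : ∀ t : ℝ, ∫ s in (0 : ℝ)..t, Real.exp (2 * M * s) = (Real.exp (2 * M * t) - 1) / (2 * M) := by
    intro t
    have h1 : ∀ s ∈ Set.uIcc 0 t, HasDerivAt (fun s => Real.exp (2 * M * s) / (2 * M))
        (Real.exp (2 * M * s)) s := by
      intro s _
      have := ((hasDerivAt_id s).const_mul (2 * M)).exp.div_const (2 * M)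
      refine this.congr_deriv ?_
      simp only [id]
      field_simp
    rw [intervalIntegral.integral_eq_sub_of_hasDerivAt h1
      (Continuous.intervalIntegrable (by fun_prop) _ _)]
    simp; ring
  have hbd : ∀ (y : BoundedContinuousFunction ℝ E) (t : ℝ), 0 ≤ t →
      ‖∫ s in (0 : ℝ)..t, Real.exp (2 * M * s) • A s (y s)‖ ≤
        Real.exp (2 * M * t) * (‖y‖ / 2) := by
    intro y t ht
    have h1 : ‖∫ s in (0 : ℝ)..t, Real.exp (2 * M * s) • A s (y s)‖ ≤
        ∫ s in (0 : ℝ)..t, Real.exp (2 * M * s) * (M * ‖y‖) := by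
      apply intervalIntegral.norm_integral_le_of_norm_le ht
      · refine Filter.Eventually.of_forall fun s _ => ?_
        rw [norm_smul, Real.norm_of_nonneg (Real.exp_pos _).le]
        gcongr
        exact ((A s).le_opNorm _).trans (by gcongr; exacts [hAM s, y.norm_coe_le_norm s])
      · exact Continuous.intervalIntegrable (by fun_prop) _ _
    refine h1.trans ?_
    rw [intervalIntegral.integral_mul_const, hexp]
    have : (Real.exp (2 * M * t) - 1) / (2 * M) * (M * ‖y‖) =
      (Real.exp (2 * M * t) - 1) * (‖y‖ / 2) := by field_simp
    rw [this]
    gcongr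
    linarith
  let G : BoundedContinuousFunction ℝ E → ℝ → E := fun y t =>
    Real.exp (-(2 * M * max t 0)) • (x0 + ∫ s in (0 : ℝ)..(max t 0), Real.exp (2 * M * s) • A s (y s))
  have hGc : ∀ y, Continuous (G y) := by
    intro y
    have : Continuous (fun t => ∫ s in (0 : ℝ)..t, Real.exp (2 * M * s) • A s (y s)) :=
      continuous_iff_continuousAt.2 fun t => (hder y t).continuousAt
    have h2 : Continuous (fun t : ℝ => max t 0) := by fun_prop
    have h3 := this.comp h2
    exact Continuous.smul (by fun_prop) (continuous_const.add h3)
  have hGb : ∀ y t, ‖G y t‖ ≤ ‖x0‖ + ‖y‖ / 2 := by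
    intro y t
    have ht : 0 ≤ max t 0 := le_max_right _ _
    simp only [G]
    rw [norm_smul, Real.norm_of_nonneg (Real.exp_pos _).le]
    calc _ ≤ Real.exp (-(2 * M * max t 0)) * (Real.exp (2 * M * max t 0) * ‖x0‖ +
          Real.exp (2 * M * max t 0) * (‖y‖ / 2)) := by
          gcongr
          refine (norm_add_le _ _).trans (add_le_add ?_ (hbd y _ ht))
          refine le_mul_of_one_le_left (norm_nonneg _) (Real.one_le_exp (by positivity))
      _ = _ := by
          rw [← mul_add, ← mul_assoc, ← Real.exp_add]; simp
  let F : BoundedContinuousFunction ℝ E → BoundedContinuousFunction ℝ E := fun y =>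
    BoundedContinuousFunction.ofNormedAddCommGroup (G y) (hGc y) _ (hGb y)
  have hF : ContractingWith (1/2) F := by
    refine ⟨by rw [← NNReal.coe_lt_coe]; norm_num, LipschitzWith.of_dist_le_mul fun y z => ?_⟩
    rw [BoundedContinuousFunction.dist_le (by positivity)]
    intro t
    have ht : 0 ≤ max t 0 := le_max_right _ _
    have e : F y t - F z t = Real.exp (-(2 * M * max t 0)) •
        ∫ s in (0 : ℝ)..(max t 0), Real.exp (2 * M * s) • A s ((y - z) s) := by
      change G y t - G z t = _
      simp only [G]
      rw [← smul_sub, add_sub_add_left_eq_sub, ← intervalIntegral.integral_sub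
        ((hcont y).intervalIntegrable _ _) ((hcont z).intervalIntegrable _ _)]
      simp [smul_sub]
    rw [dist_eq_norm, e, norm_smul, Real.norm_of_nonneg (Real.exp_pos _).le, dist_eq_norm]
    calc _ ≤ Real.exp (-(2 * M * max t 0)) * (Real.exp (2 * M * max t 0) * (‖y - z‖ / 2)) := by
          gcongr
          exact hbd _ _ ht
      _ = _ := by
          rw [← mul_assoc, ← Real.exp_add]; simp; ring
  obtain ⟨y, hy⟩ : ∃ y, F y = y := ⟨_, hF.fixedPoint_isFixedPt⟩
  refine ⟨fun t => x0 + ∫ s in (0 : ℝ)..t, Real.exp (2 * M * s) • A s (y s), by simp, ?_⟩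
  intro t ht
  have h1 : y t = Real.exp (-(2 * M * t)) •
      (x0 + ∫ s in (0 : ℝ)..t, Real.exp (2 * M * s) • A s (y s)) := by
    have : y t = G y t := by
      conv_lhs => rw [← hy]
      rfl
    rw [this]
    simp only [G, max_eq_left ht]
  have h2 : x0 + ∫ s in (0 : ℝ)..t, Real.exp (2 * M * s) • A s (y s) =
      Real.exp (2 * M * t) • y t := by
    rw [h1, smul_smul, ← Real.exp_add]; simp
  beta_reduce
  rw [h2, map_smul]
  exact (hder y t).const_add x0

theorem real_bound (c r : ℝ) (hr : 2 < r) (hc : 0 < c) (φ : ℝ → ℝ)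
    (hφ : ∀ t, φ t = 2 * Real.pi * (1 + c * t) ^ r) (a d p q : ℝ → ℝ)
    (ha : ∀ t, 0 ≤ t → HasDerivAt a
      (-2 * (Real.sin (φ t) * p t + Real.cos (φ t) * q t) + 4 * d t) t)
    (hd : ∀ t, 0 ≤ t → HasDerivAt d
      (2 * (Real.sin (φ t) * p t + Real.cos (φ t) * q t) - 6 * d t) t)
    (hp : ∀ t, 0 ≤ t → HasDerivAt p
      (-Real.sin (φ t) * (d t - a t) - 9 / 2 * p t - 4 * d t) t)
    (hq : ∀ t, 0 ≤ t → HasDerivAt q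
      (-Real.cos (φ t) * (d t - a t) - 9 / 2 * q t) t)
    (ha0 : a 0 = 1) (hd0 : d 0 = 0) (hp0 : p 0 = 0) (hq0 : q 0 = 0) (t : ℝ) (ht : 0 ≤ t) :
    2 - (1 / (Real.pi * r * c)) * (9 / (c * (r - 2)) + 4) ≤ 2 * (a t + 2 / 3 * d t) := by
  have hπ := Real.pi_pos
  have hr2 : 0 < r - 2 := by linarith
  have hr0 : 0 < r := by linarith
  -- the energy is nonincreasing
  have hE : ∀ t, 0 ≤ t →
      5 * (a t + d t) ^ 2 + (a t - d t) ^ 2 + 4 * (p t ^ 2 + q t ^ 2) ≤ 6 := by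
    intro t ht
    have hder : ∀ t, 0 ≤ t → HasDerivAt
        (fun t => 5 * (a t + d t) ^ 2 + (a t - d t) ^ 2 + 4 * (p t ^ 2 + q t ^ 2))
        (-(40 * d t ^ 2 + 36 * (p t ^ 2 + q t ^ 2) + 32 * p t * d t)) t := by
      intro t ht
      have h := (((((ha t ht).add (hd t ht)).pow 2).const_mul 5).add
        (((ha t ht).sub (hd t ht)).pow 2)).add
        ((((hp t ht).pow 2).add ((hq t ht).pow 2)).const_mul 4)
      refine h.congr_deriv ?_
      simp
      ring
    have hanti : AntitoneOn
        (fun t => 5 * (a t + d t) ^ 2 + (a t - d t) ^ 2 + 4 * (p t ^ 2 + q t ^ 2)) (Set.Ici 0) := by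
      refine antitoneOn_of_deriv_nonpos (convex_Ici 0)
        (fun x hx => (hder x hx).continuousAt.continuousWithinAt)
        (fun x hx => ((hder x (interior_subset hx)).differentiableAt.differentiableWithinAt)) ?_
      intro x hx
      rw [(hder x (interior_subset hx)).deriv]
      nlinarith [sq_nonneg (d x + p x), sq_nonneg (d x), sq_nonneg (p x), sq_nonneg (q x)]
    have := hanti (Set.mem_Ici.2 le_rfl) (Set.mem_Ici.2 ht) ht
    simp only [ha0, hd0, hp0, hq0] at this
    linarith
  have hb2 : ∀ t, 0 ≤ t → p t ^ 2 + q t ^ 2 ≤ 3 / 2 := by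
    intro t ht
    nlinarith [hE t ht, sq_nonneg (a t + d t), sq_nonneg (a t - d t)]
  have hdb : ∀ t, 0 ≤ t → |d t| ≤ 27 / 20 := by
    intro t ht
    apply abs_le_of_sq_le_sq _ (by norm_num)
    nlinarith [hE t ht, sq_nonneg (3 * a t + 2 * d t), sq_nonneg (p t), sq_nonneg (q t)]
  have hwb : ∀ t, 0 ≤ t → |-Real.cos (φ t) * p t + Real.sin (φ t) * q t| ≤ 5 / 4 := by
    intro t ht
    apply abs_le_of_sq_le_sq _ (by norm_num)
    nlinarith [hb2 t ht, sq_nonneg (Real.sin (φ t) * p t + Real.cos (φ t) * q t),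
      Real.sin_sq_add_cos_sq (φ t), sq_nonneg (p t), sq_nonneg (q t)]
  -- phase
  set e : ℝ := 1 / (2 * Real.pi * r * c) with he
  have he0 : 0 < e := by positivity
  let ψ : ℝ → ℝ := fun t => e * (1 + c * t) ^ (1 - r)
  let ψ' : ℝ → ℝ := fun t => e * (c * (1 - r) * (1 + c * t) ^ (-r))
  let T : ℝ → ℝ := fun t => e / (c * (r - 2)) * (1 + c * t) ^ (2 - r)
  have hbase : ∀ t, 0 ≤ t → 0 < 1 + c * t := fun t ht => by positivity
  have hlin : ∀ t, HasDerivAt (fun t : ℝ => 1 + c * t) c t := by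
    intro t
    simpa using ((hasDerivAt_id t).const_mul c).const_add 1
  have hφd : ∀ t, 0 ≤ t → HasDerivAt φ (2 * Real.pi * (c * r * (1 + c * t) ^ (r - 1))) t := by
    intro t ht
    rw [show φ = fun t => 2 * Real.pi * (1 + c * t) ^ r from funext hφ]
    exact ((hlin t).rpow_const (Or.inl (hbase t ht).ne')).const_mul _
  have hψd : ∀ t, 0 ≤ t → HasDerivAt ψ (ψ' t) t := by
    intro t ht
    refine (((hlin t).rpow_const (p := 1 - r) (Or.inl (hbase t ht).ne')).const_mul e).congr_deriv ?_
    simp only [ψ']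
    rw [show 1 - r - 1 = -r by ring]
  have hTd : ∀ t, 0 ≤ t → HasDerivAt T (-ψ t) t := by
    intro t ht
    refine (((hlin t).rpow_const (p := 2 - r) (Or.inl (hbase t ht).ne')).const_mul
      (e / (c * (r - 2)))).congr_deriv ?_
    simp only [ψ]
    rw [show 2 - r - 1 = 1 - r by ring]
    field_simp
    ring
  have hψ0 : ∀ t, 0 ≤ t → 0 ≤ ψ t := fun t ht =>
    mul_nonneg he0.le (Real.rpow_nonneg (hbase t ht).le _)
  have hT0 : ∀ t, 0 ≤ t → 0 ≤ T t := fun t ht =>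
    mul_nonneg (by positivity) (Real.rpow_nonneg (hbase t ht).le _)
  have hψ'0 : ∀ t, 0 ≤ t → ψ' t ≤ 0 := fun t ht => by
    have h1 := Real.rpow_nonneg (hbase t ht).le (-r)
    have h2 : 0 ≤ c * (r - 1) * (1 + c * t) ^ (-r) := mul_nonneg (by nlinarith) h1
    have : ψ' t = - (e * (c * (r - 1) * (1 + c * t) ^ (-r))) := by simp only [ψ']; ring
    rw [this]
    have := mul_nonneg he0.le h2
    linarith
  have hφψ : ∀ t, 0 ≤ t → (2 * Real.pi * (c * r * (1 + c * t) ^ (r - 1))) * ψ t = 1 := by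
    intro t ht
    have h1 : (1 + c * t) ^ (r - 1) * (1 + c * t) ^ (1 - r) = 1 := by
      rw [← Real.rpow_add (hbase t ht)]; simp
    simp only [ψ, he]
    field_simp
    linarith
  let S : ℝ → ℝ := fun t => a t + 2 / 3 * d t +
    2 / 3 * ((-Real.cos (φ t) * p t + Real.sin (φ t) * q t) * ψ t)
    - 2 / 3 * (12 * T t + 5 / 4 * ψ t)
  have hSd : ∀ t, 0 ≤ t → HasDerivAt S
      (2 / 3 * ((-(9 / 2) * (-Real.cos (φ t) * p t + Real.sin (φ t) * q t)
        + 4 * (Real.cos (φ t) * d t)) * ψ t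
        + (-Real.cos (φ t) * p t + Real.sin (φ t) * q t) * ψ' t)
        + 2 / 3 * (12 * ψ t - 5 / 4 * ψ' t)) t := by
    intro t ht
    have h := (((ha t ht).add ((hd t ht).const_mul (2/3))).add
      ((((((hφd t ht).cos.neg).mul (hp t ht)).add ((hφd t ht).sin.mul (hq t ht))).mul
        (hψd t ht)).const_mul (2/3))).sub
      ((((hTd t ht).const_mul 12).add ((hψd t ht).const_mul (5/4))).const_mul (2/3))
    refine h.congr_deriv ?_
    simp only [Pi.add_apply, Pi.mul_apply, Pi.neg_apply]
    linear_combination (2/3) * (Real.sin (φ t) * p t + Real.cos (φ t) * q t) * hφψ t ht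
  have hmono : MonotoneOn S (Set.Ici 0) := by
    refine monotoneOn_of_deriv_nonneg (convex_Ici 0)
        (fun x hx => (hSd x hx).continuousAt.continuousWithinAt)
        (fun x hx => ((hSd x (interior_subset hx)).differentiableAt.differentiableWithinAt)) ?_
    intro x hx
    have hx0 : 0 ≤ x := interior_subset hx
    rw [(hSd x hx0).deriv]
    have h1 := abs_le.1 (hwb x hx0)
    have h2 : |Real.cos (φ x) * d x| ≤ 27 / 20 := by
      rw [abs_mul]
      calc _ ≤ 1 * |d x| := by gcongr; exact Real.abs_cos_le_one _
        _ ≤ _ := by simpa using hdb x hx0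
    have h2 := abs_le.1 h2
    have h3 : 0 ≤ (12 + (-(9 / 2) * (-Real.cos (φ x) * p x + Real.sin (φ x) * q x)
        + 4 * (Real.cos (φ x) * d x))) * ψ x := mul_nonneg (by linarith) (hψ0 x hx0)
    have h4 : 0 ≤ (5 / 4 - (-Real.cos (φ x) * p x + Real.sin (φ x) * q x)) * (-ψ' x) :=
      mul_nonneg (by linarith) (by linarith [hψ'0 x hx0])
    linarith
  have hS := hmono (Set.mem_Ici.2 le_rfl) (Set.mem_Ici.2 ht) ht
  have hS0 : S 0 = 1 - 2 / 3 * (12 * (e / (c * (r - 2))) + 5 / 4 * e) := by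
    simp only [S, T, ψ, ha0, hd0, hp0, hq0]
    simp
  have hSt : S t ≤ a t + 2 / 3 * d t := by
    have h1 := abs_le.1 (hwb t ht)
    have h3 : 0 ≤ (5 / 4 - (-Real.cos (φ t) * p t + Real.sin (φ t) * q t)) * ψ t :=
      mul_nonneg (by linarith) (hψ0 t ht)
    have := hT0 t ht
    simp only [S]
    linarith
  have e1 : (1 / (Real.pi * r * c)) * (9 / (c * (r - 2)) + 4) = 18 * (e / (c * (r - 2))) + 8 * e := by
    rw [he]; field_simp; ring
  have : 0 < e / (c * (r - 2)) := by positivity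
  rw [e1]
  linarith

theorem trace_le_traceNorm {n : Type*} [Fintype n] [DecidableEq n] (A : Matrix n n ℂ) (w : n → ℝ)
    (hw : ∀ i, |w i| ≤ 1) : ∑ i, w i * (A i i).re ≤ traceNorm A := by
  set hH := (Matrix.posSemidef_conjTranspose_mul_self A).isHermitian
  let v := hH.eigenvectorBasis
  let C : Matrix n n ℂ := Matrix.diagonal fun i => (w i : ℂ)
  have h0 : ∑ i, w i * (A i i).re = ((C * A).trace).re := by
    simp [C, Matrix.trace, Matrix.diagonal_mul]
  have h1 : (C * A).trace = ∑ i, inner ℂ (v i) (Matrix.toEuclideanLin (C * A) (v i)) := by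
    rw [← LinearMap.trace_eq_sum_inner _ v]
    rw [Matrix.toEuclideanLin_eq_toLin_orthonormal]
    exact (Matrix.trace_toLin_eq _ _).symm
  rw [h0, h1, Complex.re_sum]
  unfold traceNorm
  refine Finset.sum_le_sum fun i _ => ?_
  have hsq : ‖Matrix.toEuclideanLin A (v i)‖ = Real.sqrt (hH.eigenvalues i) := by
    rw [hH.eigenvalues_eq, ← Matrix.mulVec_mulVec, Matrix.dotProduct_mulVec, ← Matrix.star_mulVec]
    rw [EuclideanSpace.norm_eq]
    congr 1
    simp [dotProduct, Matrix.toLpLin_apply, v, Complex.sq_norm, Complex.normSq_apply]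
  have hC : ∀ x : EuclideanSpace ℂ n, ‖Matrix.toEuclideanLin C x‖ ≤ ‖x‖ := by
    intro x
    rw [EuclideanSpace.norm_eq, EuclideanSpace.norm_eq]
    apply Real.sqrt_le_sqrt
    refine Finset.sum_le_sum fun j _ => ?_
    simp [C, Matrix.toLpLin_apply, Matrix.mulVec_diagonal]
    gcongr
    exact mul_le_of_le_one_left (norm_nonneg _) (hw j)
  have hmul : Matrix.toEuclideanLin (C * A) (v i) =
      Matrix.toEuclideanLin C (Matrix.toEuclideanLin A (v i)) := by
    simp [Matrix.toLpLin_apply]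
  rw [← hsq, hmul]
  calc _ ≤ ‖inner ℂ (v i) (Matrix.toEuclideanLin C (Matrix.toEuclideanLin A (v i)))‖ :=
        Complex.re_le_norm _
    _ ≤ ‖v i‖ * ‖Matrix.toEuclideanLin C (Matrix.toEuclideanLin A (v i))‖ := norm_inner_le_norm _ _
    _ ≤ 1 * ‖Matrix.toEuclideanLin A (v i)‖ := by
      rw [v.norm_eq_one]
      gcongr
      exact hC _
    _ = _ := one_mul _

/-- The jump operators of the counterexample. -/
noncomputable def jumps : Fin 3 → Matrix (Fin 2 × Fin 2) (Fin 2 × Fin 2) ℂ :=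
  ![(!![1, 0; 0, -1] + (2 : ℂ) • !![0, 1; 0, 0]) ⊗ₖ
                  (1 : Matrix (Fin 2) (Fin 2) ℂ),
                !![0, 0; 0, 1] ⊗ₖ !![0, 1; 0, 0],
                !![0, 0; 0, 1] ⊗ₖ !![0, 0; 1, 0]]

/-- The Hamiltonian with phase `C = cos`, `S = sin`. -/
noncomputable def ham (C S : ℂ) : Matrix (Fin 2 × Fin 2) (Fin 2 × Fin 2) ℂ :=
  ((!![0, -Complex.I; Complex.I, 0] + C • !![0, 1; 1, 0] +
        S • !![0, -Complex.I; Complex.I, 0] :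
          Matrix (Fin 2) (Fin 2) ℂ) ⊗ₖ (1 : Matrix (Fin 2) (Fin 2) ℂ))

/-- The `σᶻ` sector of the second qubit. -/
noncomputable def sec (x : Matrix (Fin 2 × Fin 2) (Fin 2 × Fin 2) ℂ) (i j : Fin 2) : ℂ :=
  x (i, 0) (j, 0) - x (i, 1) (j, 1)

theorem sec_gen (C S : ℂ) (x : Matrix (Fin 2 × Fin 2) (Fin 2 × Fin 2) ℂ) :
    (sec (hamTerm (ham C S) x + totalDissipator jumps x) 0 0 =
      Complex.I * (C + Complex.I * S) * sec x 0 1 - Complex.I * (C - Complex.I * S) * sec x 1 0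
        + 4 * sec x 1 1) ∧
    (sec (hamTerm (ham C S) x + totalDissipator jumps x) 0 1 =
      - Complex.I * (C - Complex.I * S) * (sec x 1 1 - sec x 0 0) - 9 / 2 * sec x 0 1
        - 4 * sec x 1 1) ∧
    (sec (hamTerm (ham C S) x + totalDissipator jumps x) 1 0 =
      Complex.I * (C + Complex.I * S) * (sec x 1 1 - sec x 0 0) - 9 / 2 * sec x 1 0
        - 4 * sec x 1 1) ∧
    (sec (hamTerm (ham C S) x + totalDissipator jumps x) 1 1 =
      -(Complex.I * (C + Complex.I * S) * sec x 0 1 - Complex.I * (C - Complex.I * S) * sec x 1 0)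
        - 6 * sec x 1 1) := by
  have h2 : (starRingEnd ℂ) 2 = 2 := Complex.conj_ofNat 2
  refine ⟨?_, ?_, ?_, ?_⟩ <;>
  · simp [sec, hamTerm, totalDissipator, dissipator, ham, jumps, Fin.sum_univ_three,
      Matrix.mul_apply, Fintype.sum_prod_type, Fin.sum_univ_two, Matrix.kroneckerMap_apply,
      Matrix.one_apply]
    ring_nf
    simp only [Complex.I_sq, h2]
    ring_nf

theorem driven_eq (H : ℝ → Matrix (Fin 2 × Fin 2) (Fin 2 × Fin 2) ℂ) (φ : ℝ → ℝ)
    (hH : ∀ t, H t = ham (Real.cos (φ t)) (Real.sin (φ t))) (t : ℝ)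
    (x : Matrix (Fin 2 × Fin 2) (Fin 2 × Fin 2) ℂ) :
    driven H jumps t x = hamTerm (ham (Real.cos (φ t)) (Real.sin (φ t))) x
      + totalDissipator jumps x := by
  rw [driven, hH]

theorem sec_hasDeriv {Lt : ℝ → Matrix (Fin 2 × Fin 2) (Fin 2 × Fin 2) ℂ →
      Matrix (Fin 2 × Fin 2) (Fin 2 × Fin 2) ℂ}
    {ρ σ : ℝ → Matrix (Fin 2 × Fin 2) (Fin 2 × Fin 2) ℂ}
    (hρ : IsSolution Lt 0 ρ) (hσ : IsSolution Lt 0 σ) (i j : Fin 2) (t : ℝ) (ht : 0 ≤ t) :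
    HasDerivAt (fun t => sec (ρ t) i j - sec (σ t) i j)
      (sec (Lt t (ρ t)) i j - sec (Lt t (σ t)) i j) t := by
  exact ((hρ t ht (i, 0) (j, 0)).sub (hρ t ht (i, 1) (j, 1))).sub
    ((hσ t ht (i, 0) (j, 0)).sub (hσ t ht (i, 1) (j, 1)))

theorem re_hasDeriv {f : ℝ → ℂ} {f' : ℂ} {t : ℝ} (h : HasDerivAt f f' t) :
    HasDerivAt (fun t => (f t).re) f'.re t :=
  Complex.reCLM.hasFDerivAt.comp_hasDerivAt t h

theorem im_hasDeriv {f : ℝ → ℂ} {f' : ℂ} {t : ℝ} (h : HasDerivAt f f' t) :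
    HasDerivAt (fun t => (f t).im) f'.im t :=
  Complex.imCLM.hasFDerivAt.comp_hasDerivAt t h

theorem lower_bound (c r : ℝ) (hr : 2 < r) (hc : 0 < c)
    (φ : ℝ → ℝ) (hφ : ∀ t, φ t = 2 * Real.pi * (1 + c * t) ^ r)
    (H : ℝ → Matrix (Fin 2 × Fin 2) (Fin 2 × Fin 2) ℂ)
    (hH : ∀ t, H t = ham (Real.cos (φ t)) (Real.sin (φ t)))
    (ρ σ : ℝ → Matrix (Fin 2 × Fin 2) (Fin 2 × Fin 2) ℂ)
    (hρ : IsSolution (driven H jumps) 0 ρ) (hσ : IsSolution (driven H jumps) 0 σ)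
    (hρ0 : ρ 0 = (!![1, 0; 0, 0] : Matrix (Fin 2) (Fin 2) ℂ) ⊗ₖ
        (!![1, 0; 0, 0] : Matrix (Fin 2) (Fin 2) ℂ))
    (hσ0 : σ 0 = (!![1, 0; 0, 0] : Matrix (Fin 2) (Fin 2) ℂ) ⊗ₖ
        (!![0, 0; 0, 1] : Matrix (Fin 2) (Fin 2) ℂ)) (t : ℝ) (ht : 0 ≤ t) :
    2 - (1 / (Real.pi * r * c)) * (9 / (c * (r - 2)) + 4) ≤ traceNorm (ρ t - σ t) := by
  let f : Fin 2 → Fin 2 → ℝ → ℂ := fun i j t => sec (ρ t) i j - sec (σ t) i j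
  have hf : ∀ i j t, f i j t = sec (ρ t) i j - sec (σ t) i j := fun _ _ _ => rfl
  have h00 : ∀ t, 0 ≤ t → HasDerivAt (f 0 0)
      (Complex.I * (Real.cos (φ t) + Complex.I * Real.sin (φ t)) * f 0 1 t
        - Complex.I * (Real.cos (φ t) - Complex.I * Real.sin (φ t)) * f 1 0 t + 4 * f 1 1 t) t := by
    intro t ht
    refine (sec_hasDeriv hρ hσ 0 0 t ht).congr_deriv ?_
    simp only [driven_eq H φ hH, (sec_gen _ _ _).1, hf]
    ring
  have h01 : ∀ t, 0 ≤ t → HasDerivAt (f 0 1)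
      (- Complex.I * (Real.cos (φ t) - Complex.I * Real.sin (φ t)) * (f 1 1 t - f 0 0 t)
        - 9 / 2 * f 0 1 t - 4 * f 1 1 t) t := by
    intro t ht
    refine (sec_hasDeriv hρ hσ 0 1 t ht).congr_deriv ?_
    simp only [driven_eq H φ hH, (sec_gen _ _ _).2.1, hf]
    ring
  have h10 : ∀ t, 0 ≤ t → HasDerivAt (f 1 0)
      (Complex.I * (Real.cos (φ t) + Complex.I * Real.sin (φ t)) * (f 1 1 t - f 0 0 t)
        - 9 / 2 * f 1 0 t - 4 * f 1 1 t) t := by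
    intro t ht
    refine (sec_hasDeriv hρ hσ 1 0 t ht).congr_deriv ?_
    simp only [driven_eq H φ hH, (sec_gen _ _ _).2.2.1, hf]
    ring
  have h11 : ∀ t, 0 ≤ t → HasDerivAt (f 1 1)
      (-(Complex.I * (Real.cos (φ t) + Complex.I * Real.sin (φ t)) * f 0 1 t
        - Complex.I * (Real.cos (φ t) - Complex.I * Real.sin (φ t)) * f 1 0 t) - 6 * f 1 1 t) t := by
    intro t ht
    refine (sec_hasDeriv hρ hσ 1 1 t ht).congr_deriv ?_
    simp only [driven_eq H φ hH, (sec_gen _ _ _).2.2.2, hf]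
    ring
  have key := real_bound c r hr hc φ hφ (fun t => (f 0 0 t).re / 2) (fun t => (f 1 1 t).re / 2)
    (fun t => ((f 0 1 t).re + (f 1 0 t).re) / 4) (fun t => ((f 0 1 t).im - (f 1 0 t).im) / 4)
    (fun t ht => ((re_hasDeriv (h00 t ht)).div_const 2).congr_deriv ?_)
    (fun t ht => ((re_hasDeriv (h11 t ht)).div_const 2).congr_deriv ?_)
    (fun t ht => (((re_hasDeriv (h01 t ht)).add (re_hasDeriv (h10 t ht))).div_const 4).congr_deriv ?_)
    (fun t ht => (((im_hasDeriv (h01 t ht)).sub (im_hasDeriv (h10 t ht))).div_const 4).congr_deriv ?_)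
    ?_ ?_ ?_ ?_ t ht
  · refine key.trans ?_
    have htr := trace_le_traceNorm (ρ t - σ t)
      (fun x => (![1, 2 / 3] : Fin 2 → ℝ) x.1 * (![1, -1] : Fin 2 → ℝ) x.2) (by
        rintro ⟨i, j⟩
        fin_cases i <;> fin_cases j <;> norm_num [abs_le])
    refine le_trans (le_of_eq ?_) htr
    simp [Fintype.sum_prod_type, f, sec]
    ring
  all_goals try simp only [Complex.add_re, Complex.sub_re, Complex.mul_re, Complex.neg_re,
      Complex.add_im, Complex.sub_im, Complex.mul_im, Complex.neg_im, Complex.I_re, Complex.I_im,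
      Complex.ofReal_re, Complex.ofReal_im, Complex.re_ofNat, Complex.im_ofNat,
      show ((9 : ℂ) / 2).re = 9 / 2 by norm_num, show ((9 : ℂ) / 2).im = 0 by norm_num]
  · ring
  · ring
  · ring
  · ring
  all_goals simp [f, sec, hρ0, hσ0]

/-- The generator as a real-linear map. -/
noncomputable def genLin (P : Matrix (Fin 2 × Fin 2) (Fin 2 × Fin 2) ℂ) {m : ℕ}
    (L : Fin m → Matrix (Fin 2 × Fin 2) (Fin 2 × Fin 2) ℂ) :
    (Fin 2 × Fin 2 → Fin 2 × Fin 2 → ℂ) →ₗ[ℝ] (Fin 2 × Fin 2 → Fin 2 × Fin 2 → ℂ) where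
  toFun x := hamTerm P (Matrix.of x) + totalDissipator L (Matrix.of x)
  map_add' x y := by
    change hamTerm P (Matrix.of x + Matrix.of y) + totalDissipator L (Matrix.of x + Matrix.of y) =
      hamTerm P (Matrix.of x) + totalDissipator L (Matrix.of x) +
      (hamTerm P (Matrix.of y) + totalDissipator L (Matrix.of y))
    simp only [hamTerm, totalDissipator, dissipator, mul_add, add_mul, Finset.sum_add_distrib,
      Finset.sum_sub_distrib, smul_add, smul_sub]
    abel
  map_smul' k x := by
    change hamTerm P (k • Matrix.of x) + totalDissipator L (k • Matrix.of x) =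
      k • (hamTerm P (Matrix.of x) + totalDissipator L (Matrix.of x))
    simp only [hamTerm, totalDissipator, dissipator, Matrix.mul_smul, Matrix.smul_mul,
      smul_add, smul_sub, Finset.smul_sum, smul_comm k]

theorem exists_solution (φ : ℝ → ℝ) (hφ : Continuous φ)
    (H : ℝ → Matrix (Fin 2 × Fin 2) (Fin 2 × Fin 2) ℂ)
    (hH : ∀ t, H t = ham (Real.cos (φ t)) (Real.sin (φ t)))
    (x0 : Matrix (Fin 2 × Fin 2) (Fin 2 × Fin 2) ℂ) :
    ∃ ρ : ℝ → Matrix (Fin 2 × Fin 2) (Fin 2 × Fin 2) ℂ, ρ 0 = x0 ∧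
      IsSolution (driven H jumps) 0 ρ := by
  let B0 := LinearMap.toContinuousLinearMap (genLin (ham 0 0) jumps)
  let B1 := LinearMap.toContinuousLinearMap
    (genLin (ham 1 0) (m := 0) ![] - genLin (ham 0 0) (m := 0) ![])
  let B2 := LinearMap.toContinuousLinearMap
    (genLin (ham 0 1) (m := 0) ![] - genLin (ham 0 0) (m := 0) ![])
  let A := fun t => B0 + Real.cos (φ t) • B1 + Real.sin (φ t) • B2
  have hA : Continuous A := by fun_prop
  have hAM : ∀ t, ‖A t‖ ≤ ‖B0‖ + ‖B1‖ + ‖B2‖ + 1 := by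
    intro t
    have h1 : ‖Real.cos (φ t) • B1‖ ≤ ‖B1‖ := by
      rw [norm_smul]
      exact mul_le_of_le_one_left (norm_nonneg _) (Real.abs_cos_le_one _)
    have h2 : ‖Real.sin (φ t) • B2‖ ≤ ‖B2‖ := by
      rw [norm_smul]
      exact mul_le_of_le_one_left (norm_nonneg _) (Real.abs_sin_le_one _)
    have h3 := norm_add_le (B0 + Real.cos (φ t) • B1) (Real.sin (φ t) • B2)
    have h4 := norm_add_le B0 (Real.cos (φ t) • B1)
    simp only [A]
    linarith
  obtain ⟨x, hx0, hx⟩ := exists_linear_ode A hA _ (by positivity) hAM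
    (x0 : Fin 2 × Fin 2 → Fin 2 × Fin 2 → ℂ)
  refine ⟨fun t => Matrix.of (x t), hx0, fun t ht i j => ?_⟩
  have h := hasDerivAt_pi.1 (hasDerivAt_pi.1 (hx t ht) i) j
  refine h.congr_deriv ?_
  have e : A t (x t) = (driven H jumps t (Matrix.of (x t)) :
      Matrix (Fin 2 × Fin 2) (Fin 2 × Fin 2) ℂ) := by
    rw [driven_eq H φ hH]
    change (hamTerm (ham 0 0) (Matrix.of (x t)) + totalDissipator jumps (Matrix.of (x t))) +
      Real.cos (φ t) • ((hamTerm (ham 1 0) (Matrix.of (x t)) + totalDissipator ![] (Matrix.of (x t)))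
      - (hamTerm (ham 0 0) (Matrix.of (x t)) + totalDissipator ![] (Matrix.of (x t)))) +
      Real.sin (φ t) • ((hamTerm (ham 0 1) (Matrix.of (x t)) + totalDissipator ![] (Matrix.of (x t)))
      - (hamTerm (ham 0 0) (Matrix.of (x t)) + totalDissipator ![] (Matrix.of (x t)))) = _
    have e1 : ∀ C S : ℂ, ham C S =
        ham 0 0 + C • (ham 1 0 - ham 0 0) + S • (ham 0 1 - ham 0 0) := by
      intro C S
      ext ⟨i, k⟩ ⟨j, l⟩
      fin_cases i <;> fin_cases j <;>
        simp [ham, Matrix.kroneckerMap_apply, Matrix.add_apply] <;> ring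
    rw [e1 (Real.cos (φ t)) (Real.sin (φ t))]
    generalize Matrix.of (x t) = y
    simp only [hamTerm, ← Complex.coe_smul, add_mul, mul_add, sub_mul, mul_sub, Matrix.smul_mul,
      Matrix.mul_smul]
    module
  rw [e]

theorem density_aux (w : Fin 2 × Fin 2) :
    IsDensity (Matrix.diagonal (Pi.single w 1) : Matrix (Fin 2 × Fin 2) (Fin 2 × Fin 2) ℂ) := by
  refine ⟨Matrix.PosSemidef.diagonal ?_, ?_⟩
  · intro i
    by_cases h : i = w
    · subst h; simp
    · simp [h]
  · simp [Matrix.trace]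

theorem time_dependent_counterexample (c r : ℝ) (hr : 2 < r) (hc : 0 < c)
    (hineq : 4 + 9 / (c * (r - 2)) < 2 * Real.pi * r * c)
    (L : Fin 3 → Matrix (Fin 2 × Fin 2) (Fin 2 × Fin 2) ℂ)
    (hL : L = ![(!![1, 0; 0, -1] + (2 : ℂ) • !![0, 1; 0, 0]) ⊗ₖ
                  (1 : Matrix (Fin 2) (Fin 2) ℂ),
                !![0, 0; 0, 1] ⊗ₖ !![0, 1; 0, 0],
                !![0, 0; 0, 1] ⊗ₖ !![0, 0; 1, 0]])
    (φ : ℝ → ℝ) (hφ : ∀ t, φ t = 2 * Real.pi * (1 + c * t) ^ r)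
    (H : ℝ → Matrix (Fin 2 × Fin 2) (Fin 2 × Fin 2) ℂ)
    (hH : ∀ t, H t =
      ((!![0, -Complex.I; Complex.I, 0] +
        (Real.cos (φ t) : ℂ) • !![0, 1; 1, 0] +
        (Real.sin (φ t) : ℂ) • !![0, -Complex.I; Complex.I, 0] :
          Matrix (Fin 2) (Fin 2) ℂ) ⊗ₖ (1 : Matrix (Fin 2) (Fin 2) ℂ))) :
    (∀ ρ σ : ℝ → Matrix (Fin 2 × Fin 2) (Fin 2 × Fin 2) ℂ,
      IsSolution (driven H L) 0 ρ → IsSolution (driven H L) 0 σ →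
      ρ 0 = (!![1, 0; 0, 0] : Matrix (Fin 2) (Fin 2) ℂ) ⊗ₖ
        (!![1, 0; 0, 0] : Matrix (Fin 2) (Fin 2) ℂ) →
      σ 0 = (!![1, 0; 0, 0] : Matrix (Fin 2) (Fin 2) ℂ) ⊗ₖ
        (!![0, 0; 0, 1] : Matrix (Fin 2) (Fin 2) ℂ) →
      ∀ t : ℝ, 0 ≤ t →
        2 - (1 / (Real.pi * r * c)) * (9 / (c * (r - 2)) + 4) ≤
          traceNorm (ρ t - σ t)) ∧
    0 < 2 - (1 / (Real.pi * r * c)) * (9 / (c * (r - 2)) + 4) ∧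
    ¬ ExpContractive (driven H L) := by
  have hL' : L = jumps := hL
  have hH' : ∀ t, H t = ham (Real.cos (φ t)) (Real.sin (φ t)) := hH
  clear hL hH
  subst hL'
  have hπ := Real.pi_pos
  have hr2 : 0 < r - 2 := by linarith
  have hr0 : 0 < r := by linarith
  have hpos : 0 < 2 - (1 / (Real.pi * r * c)) * (9 / (c * (r - 2)) + 4) := by
    have : (1 / (Real.pi * r * c)) * (9 / (c * (r - 2)) + 4) < 2 := by
      rw [one_div, inv_mul_lt_iff₀ (by positivity)]
      linarith
    linarith
  refine ⟨fun ρ σ hρ hσ hρ0 hσ0 t ht =>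
    lower_bound c r hr hc φ hφ H hH' ρ σ hρ hσ hρ0 hσ0 t ht, hpos, ?_⟩
  rintro ⟨K, γ, hK, hγ, hcon⟩
  have hφc : Continuous φ := by
    rw [show φ = fun t => 2 * Real.pi * (1 + c * t) ^ r from funext hφ]
    exact continuous_const.mul ((Real.continuous_rpow_const hr0.le).comp (by fun_prop))
  obtain ⟨ρ, hρ0, hρ⟩ := exists_solution φ hφc H hH'
    ((!![1, 0; 0, 0] : Matrix (Fin 2) (Fin 2) ℂ) ⊗ₖ (!![1, 0; 0, 0] : Matrix (Fin 2) (Fin 2) ℂ))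
  obtain ⟨σ, hσ0, hσ⟩ := exists_solution φ hφc H hH'
    ((!![1, 0; 0, 0] : Matrix (Fin 2) (Fin 2) ℂ) ⊗ₖ (!![0, 0; 0, 1] : Matrix (Fin 2) (Fin 2) ℂ))
  have hdρ : IsDensity (ρ 0) := by
    convert density_aux (0, 0)
    rw [hρ0]
    ext ⟨i, j⟩ ⟨k, l⟩
    fin_cases i <;> fin_cases j <;> fin_cases k <;> fin_cases l <;> simp
  have hdσ : IsDensity (σ 0) := by
    convert density_aux (0, 1)
    rw [hσ0]
    ext ⟨i, j⟩ ⟨k, l⟩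
    fin_cases i <;> fin_cases j <;> fin_cases k <;> fin_cases l <;> simp
  have hlim : Filter.Tendsto (fun t : ℝ => K * Real.exp (-γ * (t - 0)) * traceNorm (ρ 0 - σ 0))
      Filter.atTop (nhds (K * 0 * traceNorm (ρ 0 - σ 0))) := by
    refine (Filter.Tendsto.const_mul K ?_).mul_const _
    refine Real.tendsto_exp_atBot.comp ?_
    simp only [sub_zero]
    exact Filter.tendsto_id.const_mul_atTop_of_neg (by linarith)
  have hle := ge_of_tendsto hlim (b := 2 - (1 / (Real.pi * r * c)) * (9 / (c * (r - 2)) + 4)) (by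
    filter_upwards [Filter.eventually_ge_atTop (0 : ℝ)] with t ht
    exact (lower_bound c r hr hc φ hφ H hH' ρ σ hρ hσ hρ0 hσ0 t ht).trans
      (hcon 0 t le_rfl ht ρ σ hρ hσ hdρ hdσ))
  rw [mul_zero, zero_mul] at hle
  linarith

end Paper
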